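/- Let a ∈ L be an element not lying in K. Then a + a^{q²} + a^{q⁴} ≠ 0. -/

import Mathlib

open Polynomial in
/-- An element of an extension of a finite field `K` fixed by the `|K|`-power Frobenius
lies in `K`. -/
theorem mem_range_algebraMap_of_pow_card_eq {K L : Type*} [Field K] [Fintype K] [Field L]
    [Algebra K L] {a : L} (h : a ^ Fintype.card K = a) : a ∈ Set.range (algebraMap K L) := by
  classical
  have hsplit : (X ^ Fintype.card K - X : K[X]).Splits := by
    rw [splits_iff_card_roots, FiniteField.roots_X_pow_card_sub_X,
      FiniteField.X_pow_card_sub_X_natDegree_eq K Fintype.one_lt_card]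
    rfl
  refine hsplit.mem_range_of_isRoot
    (FiniteField.X_pow_card_sub_X_ne_zero K Fintype.one_lt_card) ?_
  simp [h]

/-- Let `K` be a finite field with `q` elements and `L` a field extension of `K` of
degree `7`. If `a ∈ L` does not lie in (the image of) `K`, then
`a + a^{q²} + a^{q⁴} ≠ 0`. -/
theorem add_pow_q_sq_add_pow_q_four_ne_zero
    (K L : Type*) [Field K] [Fintype K] [Field L] [Algebra K L]
    (q : ℕ) (hq : q = Fintype.card K)
    (hdeg : Module.finrank K L = 7)
    (a : L) (ha : a ∉ Set.range (algebraMap K L)) :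
    a + a ^ q ^ 2 + a ^ q ^ 4 ≠ 0 := by
  subst hq
  intro h
  apply ha
  apply mem_range_algebraMap_of_pow_card_eq
  have : FiniteDimensional K L := Module.finite_of_finrank_pos (by omega)
  have : Finite L := Module.finite_of_finite K
  have := Fintype.ofFinite L
  set q := Fintype.card K with hq
  have hfix : a ^ q ^ 7 = a := by
    rw [hq, ← hdeg, ← Module.card_eq_pow_finrank, FiniteField.pow_card]
  have hfrob (x : L) : FiniteField.frobeniusAlgHom K L x = x ^ q := rfl
  have h2 : a ^ q ^ 2 + a ^ q ^ 4 + a ^ q ^ 6 = 0 := by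
    have := congrArg (fun x ↦ FiniteField.frobeniusAlgHom K L (FiniteField.frobeniusAlgHom K L x)) h
    simp only [map_add, map_zero] at this
    simp only [hfrob, ← pow_mul, ← pow_succ] at this
    ring_nf at this ⊢
    exact this
  have h6 : a ^ q ^ 6 = a := by linear_combination h2 - h
  calc a ^ q = (a ^ q ^ 6) ^ q := by rw [h6]
    _ = a ^ q ^ 7 := by rw [← pow_mul, ← pow_succ]
    _ = a := hfix
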